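/- arXiv:1209.1152 — 4 statements merged into one kernel-verified Lean document; each statement's English description precedes it below -/
import Mathlib

section
/- Let A be a unital C*-algebra and let a, b, c ∈ A be such that the 3×3 matrix M = [[1, a, b], [a*, 1, c], [b*, c*, 1]] is a positive element of M₃(A). If a is unitary or c is unitary, then b = ac. -/
/-- A sum of three elements `star x * x` vanishes only if each `x` does. -/
theorem sum_three_star_mul_self_eq_zero {A : Type*} [CStarAlgebra A] (x y z : A)
    (h : star x * x + star y * y + star z * z = 0) : x = 0 ∧ y = 0 ∧ z = 0 := by
  let _ := CStarAlgebra.spectralOrder A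
  have := CStarAlgebra.spectralOrderedRing A
  have hx := star_mul_self_nonneg x
  have hy := star_mul_self_nonneg y
  have hz := star_mul_self_nonneg z
  obtain ⟨h1, h2⟩ := (add_eq_zero_iff_of_nonneg (add_nonneg hx hy) hz).1 h
  obtain ⟨h3, h4⟩ := (add_eq_zero_iff_of_nonneg hx hy).1 h1
  exact ⟨CStarRing.star_mul_self_eq_zero_iff _ |>.1 h3,
    CStarRing.star_mul_self_eq_zero_iff _ |>.1 h4,
    CStarRing.star_mul_self_eq_zero_iff _ |>.1 h2⟩

/-- If two unit columns have unitary inner product `u`, then the second is the first times `u`. -/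
theorem column_eq_mul {A : Type*} [CStarAlgebra A] (p0 p1 p2 q0 q1 q2 u : A)
    (hu : star u * u = 1)
    (hpp : star p0 * p0 + star p1 * p1 + star p2 * p2 = 1)
    (hpq : star p0 * q0 + star p1 * q1 + star p2 * q2 = u)
    (hqp : star q0 * p0 + star q1 * p1 + star q2 * p2 = star u)
    (hqq : star q0 * q0 + star q1 * q1 + star q2 * q2 = 1) :
    q0 = p0 * u ∧ q1 = p1 * u ∧ q2 = p2 * u := by
  have key : star (q0 - p0 * u) * (q0 - p0 * u) + star (q1 - p1 * u) * (q1 - p1 * u)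
      + star (q2 - p2 * u) * (q2 - p2 * u) = 0 := by
    have e : star (q0 - p0 * u) * (q0 - p0 * u) + star (q1 - p1 * u) * (q1 - p1 * u)
      + star (q2 - p2 * u) * (q2 - p2 * u)
      = (star q0 * q0 + star q1 * q1 + star q2 * q2)
        - (star q0 * p0 + star q1 * p1 + star q2 * p2) * u
        - star u * (star p0 * q0 + star p1 * q1 + star p2 * q2)
        + star u * (star p0 * p0 + star p1 * p1 + star p2 * p2) * u := by
      simp only [star_sub, star_mul]
      noncomm_ring
    rw [e, hpp, hpq, hqp, hqq, mul_one, hu]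
    simp
  obtain ⟨h0, h1, h2⟩ := sum_three_star_mul_self_eq_zero _ _ _ key
  exact ⟨sub_eq_zero.1 h0, sub_eq_zero.1 h1, sub_eq_zero.1 h2⟩

/-- **The multiplicative-domain identity from Lemma 2.8.**
Let `A` be a unital C*-algebra and `a b c ∈ A` be such that the `3 × 3` matrix
`M = [[1, a, b], [a*, 1, c], [b*, c*, 1]]` is a positive element of the C*-algebra `M₃(A)`
(positivity in a C*-algebra meaning being of the form `star y * y`).
If `a` is unitary or `c` is unitary, then `b = a * c`. -/
theorem eq_mul_of_corner_posElem {A : Type*} [CStarAlgebra A] (a b c : A)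
    (hM : ∃ y : Matrix (Fin 3) (Fin 3) A,
      !![1, a, b; star a, 1, c; star b, star c, 1] = star y * y)
    (h : a ∈ unitary A ∨ c ∈ unitary A) :
    b = a * c := by
  obtain ⟨y, hy⟩ := hM
  have E : ∀ i j, (!![1, a, b; star a, 1, c; star b, star c, 1] : Matrix (Fin 3) (Fin 3) A) i j
      = star (y 0 i) * y 0 j + star (y 1 i) * y 1 j + star (y 2 i) * y 2 j := by
    intro i j
    rw [hy, Matrix.mul_apply, Fin.sum_univ_three]
    rfl
  have e00 : (1 : A) = _ := E 0 0
  have e01 : a = _ := E 0 1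
  have e02 : b = _ := E 0 2
  have e10 : star a = _ := E 1 0
  have e11 : (1 : A) = _ := E 1 1
  have e12 : c = _ := E 1 2
  have e21 : star c = _ := E 2 1
  have e22 : (1 : A) = _ := E 2 2
  rcases h with h | h
  · obtain ⟨h0, h1, h2⟩ := column_eq_mul _ _ _ _ _ _ a (Unitary.star_mul_self_of_mem h)
      e00.symm e01.symm e10.symm e11.symm
    have hc : c = star a * b := by
      rw [e12, h0, h1, h2, e02]
      simp only [star_mul, mul_add, mul_assoc]
    rw [hc, ← mul_assoc, Unitary.mul_star_self_of_mem h, one_mul]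
  · obtain ⟨h0, h1, h2⟩ := column_eq_mul _ _ _ _ _ _ c (Unitary.star_mul_self_of_mem h)
      e11.symm e12.symm e21.symm e22.symm
    calc b = _ := e02
      _ = (star (y 0 0) * y 0 1 + star (y 1 0) * y 1 1 + star (y 2 0) * y 2 1) * c := by
        rw [h0, h1, h2]
        simp only [add_mul, mul_assoc]
      _ = a * c := by rw [← e01]
end

section
/- For all real numbers α, β, the real 4×4 matrix [[α, 0, 1, 0], [0, β, 2, −1], [1, 2, 3−α, 0], [0, −1, 0, 3−β]] is not positive semidefinite. -/
/-- **The finite obstruction from the proof of Theorem 4.8.**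
For all real numbers `α, β`, the real `4 × 4` matrix
`[[α, 0, 1, 0], [0, β, 2, −1], [1, 2, 3−α, 0], [0, −1, 0, 3−β]]` is not positive
semidefinite. -/
theorem not_posSemidef_obstruction (α β : ℝ) :
    ¬ (!![α, 0, 1, 0; 0, β, 2, -1; 1, 2, 3 - α, 0; 0, -1, 0, 3 - β] :
        Matrix (Fin 4) (Fin 4) ℝ).PosSemidef := by
  intro h
  -- the quadratic form takes the value `-2` at `(1, 1, -1, 1)`
  have h1 := h.dotProduct_mulVec_nonneg ![1, 1, -1, 1]
  simp [Matrix.mulVec, dotProduct, Fin.sum_univ_four] at h1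
  linarith
end

section
/- Let p ≥ 1 and let X₁, X₂, X₃, X₄, Y₁, Y₂, Y₃, Y₄ ∈ M_p(ℂ) be positive semidefinite matrices with X₁ + X₂ = X₃ + X₄ and Y₁ + Y₂ = Y₃ + Y₄ = I. Set q_{i,j} = Tr(X_i Y_j), which is a nonnegative real number for each i, j. Then for every choice of a, b, c ∈ {0, 2}: Tr(X₁ + X₂) ≤ Σ_{j=1}^{2} Σ_{k=1}^{2} Σ_{i=1}^{2} √(q_{b+i, a+j}) · √(q_{b+i, c+k}). -/
open scoped ComplexOrder

theorem bell_sqrt_add (x y : ℝ) : √(x + y) ≤ √x + √y := by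
  rcases le_total 0 x with hx | hx
  · rcases le_total 0 y with hy | hy
    · rw [Real.sqrt_le_left (by positivity)]
      nlinarith [Real.sq_sqrt hx, Real.sq_sqrt hy, Real.sqrt_nonneg x, Real.sqrt_nonneg y,
        mul_nonneg (Real.sqrt_nonneg x) (Real.sqrt_nonneg y)]
    · have := Real.sqrt_le_sqrt (show x + y ≤ x by linarith)
      linarith [Real.sqrt_nonneg y]
  · have := Real.sqrt_le_sqrt (show x + y ≤ y by linarith)
    linarith [Real.sqrt_nonneg x]

theorem bell_aux (r x y z w : ℝ) (h1 : x + y = r) (h2 : z + w = r) :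
    r ≤ (√x + √y) * (√z + √w) := by
  have e1 := bell_sqrt_add x y
  have e2 := bell_sqrt_add z w
  rw [h1] at e1
  rw [h2] at e2
  have h3 : r ≤ √r * √r := by
    rcases le_total 0 r with hr | hr
    · rw [Real.mul_self_sqrt hr]
    · exact hr.trans (mul_self_nonneg _)
  exact h3.trans (mul_le_mul e1 e2 (Real.sqrt_nonneg _) ((Real.sqrt_nonneg _).trans e1))

/-- **The Bell-type inequality with square roots** (Lemma 6.14).
Let `X₁, X₂, X₃, X₄, Y₁, Y₂, Y₃, Y₄ ∈ M_p(ℂ)` be positive semidefinite with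
`X₁ + X₂ = X₃ + X₄` and `Y₁ + Y₂ = Y₃ + Y₄ = I`, and let `q i j = Tr(X_i Y_j)` (a real
number). Then for all `a, b, c ∈ {0, 2}`:
`Tr(X₁ + X₂) ≤ ∑_{j=1}^{2} ∑_{k=1}^{2} ∑_{i=1}^{2} √(q (b+i) (a+j)) · √(q (b+i) (c+k))`. -/
theorem bell_type_inequality {p : ℕ} (hp : 1 ≤ p)
    (X Y : ℕ → Matrix (Fin p) (Fin p) ℂ)
    (hX : ∀ i, 1 ≤ i → i ≤ 4 → (X i).PosSemidef)
    (hY : ∀ j, 1 ≤ j → j ≤ 4 → (Y j).PosSemidef)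
    (hXsum : X 1 + X 2 = X 3 + X 4)
    (hYsum₁ : Y 1 + Y 2 = 1) (hYsum₂ : Y 3 + Y 4 = 1)
    (q : ℕ → ℕ → ℝ) (hq : ∀ i j, (q i j : ℂ) = (X i * Y j).trace)
    (t : ℝ) (ht : (t : ℂ) = (X 1 + X 2).trace)
    (a b c : ℕ) (ha : a = 0 ∨ a = 2) (hb : b = 0 ∨ b = 2) (hc : c = 0 ∨ c = 2) :
    t ≤ ∑ j ∈ Finset.Icc 1 2, ∑ k ∈ Finset.Icc 1 2, ∑ i ∈ Finset.Icc 1 2,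
        Real.sqrt (q (b + i) (a + j)) * Real.sqrt (q (b + i) (c + k)) := by
  have hY' : ∀ d, d = 0 ∨ d = 2 → Y (d + 1) + Y (d + 2) = 1 := by
    rintro d (rfl | rfl)
    · simpa using hYsum₁
    · simpa using hYsum₂
  have key : ∀ i d, d = 0 ∨ d = 2 → ((q i (d + 1) + q i (d + 2) : ℝ) : ℂ) = (X i).trace := by
    intro i d hd
    push_cast
    rw [hq, hq, ← Matrix.trace_add, ← Matrix.mul_add, hY' d hd, Matrix.mul_one]
  have hs : ∀ i, q i (a + 1) + q i (a + 2) = q i (c + 1) + q i (c + 2) := by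
    intro i
    have := (key i a ha).trans (key i c hc).symm
    exact_mod_cast this
  have htt : t = (q (b + 1) (a + 1) + q (b + 1) (a + 2)) +
      (q (b + 2) (a + 1) + q (b + 2) (a + 2)) := by
    have : (t : ℂ) = ((q (b + 1) (a + 1) + q (b + 1) (a + 2) : ℝ) : ℂ) +
        ((q (b + 2) (a + 1) + q (b + 2) (a + 2) : ℝ) : ℂ) := by
      rw [key _ _ ha, key _ _ ha, ht, ← Matrix.trace_add]
      rcases hb with rfl | rfl
      · simp
      · rw [hXsum]
    exact_mod_cast this
  have g1 := bell_aux _ _ _ _ _ rfl (hs (b + 1)).symm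
  have g2 := bell_aux _ _ _ _ _ rfl (hs (b + 2)).symm
  have hI : Finset.Icc 1 2 = ({1, 2} : Finset ℕ) := by decide
  simp only [hI, Finset.sum_pair (show (1 : ℕ) ≠ 2 by decide)]
  rw [htt]
  linarith
end

section
/- Let p ≥ 1 and let X₁, X₂, X₃, X₄, Y₁, Y₂, Y₃, Y₄ ∈ M_p(ℂ) be positive semidefinite matrices with X₁ + X₂ = X₃ + X₄ and Y₁ + Y₂ = Y₃ + Y₄ = I, and set q_{i,j} = Tr(X_i Y_j), a nonnegative real number. Then for every choice of d, a, b, c ∈ {0, 2}: Σ_{i=1}^{2} Σ_{j=1}^{2} q_{d+i, d+j} ≤ Σ_{j=1}^{2} Σ_{k=1}^{2} Σ_{i=1}^{2} √(q_{b+i, a+j}) · √(q_{b+i, c+k}). -/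
open scoped ComplexOrder

/-- The trace of a product of two positive semidefinite matrices is nonnegative. -/
theorem trace_mul_nonneg_aux {p : ℕ} {A B : Matrix (Fin p) (Fin p) ℂ}
    (hA : A.PosSemidef) (hB : B.PosSemidef) : 0 ≤ (A * B).trace := by
  obtain ⟨C, rfl⟩ : ∃ C : Matrix (Fin p) (Fin p) ℂ, A = C.conjTranspose * C := by
    open scoped MatrixOrder in
    exact CStarAlgebra.nonneg_iff_eq_star_mul_self.mp hA.nonneg
  rw [Matrix.mul_assoc, Matrix.trace_mul_comm]
  exact (hB.mul_mul_conjTranspose_same C).trace_nonneg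

/-- Subadditivity of the square root. -/
theorem sqrt_add_aux {x y : ℝ} (hx : 0 ≤ x) (hy : 0 ≤ y) : √(x + y) ≤ √x + √y := by
  apply Real.sqrt_le_iff.mpr ⟨by positivity, ?_⟩
  have h := mul_nonneg (Real.sqrt_nonneg x) (Real.sqrt_nonneg y)
  nlinarith [Real.sq_sqrt hx, Real.sq_sqrt hy]

/-- Scalar inequality used for each row. -/
theorem row_aux {x y z w t : ℝ} (hx : 0 ≤ x) (hy : 0 ≤ y) (hz : 0 ≤ z) (hw : 0 ≤ w)
    (h1 : x + y = t) (h2 : z + w = t) :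
    t ≤ √x * √z + √x * √w + √y * √z + √y * √w := by
  have ht : 0 ≤ t := by linarith
  have e1 : √t ≤ √x + √y := h1 ▸ sqrt_add_aux hx hy
  have e2 : √t ≤ √z + √w := h2 ▸ sqrt_add_aux hz hw
  have := mul_le_mul e1 e2 (Real.sqrt_nonneg t) (by positivity)
  rw [Real.mul_self_sqrt ht] at this
  linarith

/-- **The correlation form of the Bell-type inequality** (Theorem 6.15, concrete form).
Let `X₁, X₂, X₃, X₄, Y₁, Y₂, Y₃, Y₄ ∈ M_p(ℂ)` be positive semidefinite with
`X₁ + X₂ = X₃ + X₄` and `Y₁ + Y₂ = Y₃ + Y₄ = I`, and set `q i j = Tr(X_i Y_j)` (a real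
number). Then for all `d, a, b, c ∈ {0, 2}`:
`∑_{i=1}^{2} ∑_{j=1}^{2} q (d+i) (d+j)
  ≤ ∑_{j=1}^{2} ∑_{k=1}^{2} ∑_{i=1}^{2} √(q (b+i) (a+j)) · √(q (b+i) (c+k))`. -/
theorem bell_type_inequality_correlation {p : ℕ} (hp : 1 ≤ p)
    (X Y : ℕ → Matrix (Fin p) (Fin p) ℂ)
    (hX : ∀ i, 1 ≤ i → i ≤ 4 → (X i).PosSemidef)
    (hY : ∀ j, 1 ≤ j → j ≤ 4 → (Y j).PosSemidef)
    (hXsum : X 1 + X 2 = X 3 + X 4)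
    (hYsum₁ : Y 1 + Y 2 = 1) (hYsum₂ : Y 3 + Y 4 = 1)
    (q : ℕ → ℕ → ℝ) (hq : ∀ i j, (q i j : ℂ) = (X i * Y j).trace)
    (d a b c : ℕ) (hd : d = 0 ∨ d = 2)
    (ha : a = 0 ∨ a = 2) (hb : b = 0 ∨ b = 2) (hc : c = 0 ∨ c = 2) :
    ∑ i ∈ Finset.Icc 1 2, ∑ j ∈ Finset.Icc 1 2, q (d + i) (d + j) ≤
      ∑ j ∈ Finset.Icc 1 2, ∑ k ∈ Finset.Icc 1 2, ∑ i ∈ Finset.Icc 1 2,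
        Real.sqrt (q (b + i) (a + j)) * Real.sqrt (q (b + i) (c + k)) := by
  have hn : ∀ i j, 1 ≤ i → i ≤ 4 → 1 ≤ j → j ≤ 4 → 0 ≤ q i j := by
    intro i j h1 h2 h3 h4
    have := trace_mul_nonneg_aux (hX i h1 h2) (hY j h3 h4)
    rw [← hq] at this
    exact_mod_cast this
  have hs : ∀ i e, (e = 0 ∨ e = 2) → q i (e + 1) + q i (e + 2) = (X i).trace.re := by
    intro i e he
    have h : ((q i (e + 1) + q i (e + 2) : ℝ) : ℂ) = (X i).trace := by
      push_cast
      rw [hq, hq, ← Matrix.trace_add, ← Matrix.mul_add]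
      rcases he with rfl | rfl
      · simp [hYsum₁]
      · simp [hYsum₂]
    rw [← h, Complex.ofReal_re]
  have hT : ∀ e, (e = 0 ∨ e = 2) → (X (e + 1)).trace.re + (X (e + 2)).trace.re
      = (X 1).trace.re + (X 2).trace.re := by
    rintro e (rfl | rfl)
    · simp
    · have := congrArg (fun M => (Matrix.trace M).re) hXsum
      simp only [Matrix.trace_add, Complex.add_re] at this
      exact this.symm
  have row : ∀ i, 1 ≤ i → i ≤ 4 → _ := fun i h1 h2 =>
    row_aux (hn i (a + 1) h1 h2 (by omega) (by omega)) (hn i (a + 2) h1 h2 (by omega) (by omega))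
      (hn i (c + 1) h1 h2 (by omega) (by omega)) (hn i (c + 2) h1 h2 (by omega) (by omega))
      (hs i a ha) (hs i c hc)
  have r1 := row (b + 1) (by omega) (by omega)
  have r2 := row (b + 2) (by omega) (by omega)
  have hI : Finset.Icc 1 2 = ({1, 2} : Finset ℕ) := by decide
  have s1 := hs (d + 1) d hd
  have s2 := hs (d + 2) d hd
  have t1 := hT d hd
  have t2 := hT b hb
  simp only [hI, Finset.sum_pair (show (1 : ℕ) ≠ 2 by decide)]
  linarith
end
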